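/- Define g : ℝ → ℝ by g(z) = (2/π)^{1/4}·exp(π²/12 + z − ∫₀^{e^z} (log(1+t)/t) dt). Then g is log-concave on ℝ; in fact, the function z ↦ −log g(z) is (strictly) convex, its second derivative being (−log g)''(z) = e^z/(1+e^z) > 0 for all z ∈ ℝ. -/

import Mathlib

lemma intervalIntegrable_log_one_add_div {x : ℝ} (hx : 0 ≤ x) :
    IntervalIntegrable (fun t : ℝ => Real.log (1 + t) / t) MeasureTheory.volume 0 x := by
  refine (intervalIntegrable_const (c := (1 : ℝ))).mono_fun
    (by fun_prop : Measurable fun t : ℝ => Real.log (1 + t) / t).aestronglyMeasurable ?_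
  filter_upwards [MeasureTheory.ae_restrict_mem measurableSet_uIoc] with t ht
  rw [Set.uIoc_of_le hx] at ht
  have hlog : Real.log (1 + t) ≤ t := by
    linarith [Real.log_le_sub_one_of_pos (add_pos one_pos ht.1)]
  have hnonneg : 0 ≤ Real.log (1 + t) := Real.log_nonneg (by linarith [ht.1])
  rw [norm_one, Real.norm_of_nonneg (div_nonneg hnonneg ht.1.le)]
  exact div_le_one_of_le₀ hlog ht.1.le

lemma hasDerivAt_integral_log_one_add_div {x : ℝ} (hx : 0 < x) :
    HasDerivAt (fun y : ℝ => ∫ t in (0 : ℝ)..y, Real.log (1 + t) / t)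
      (Real.log (1 + x) / x) x := by
  refine intervalIntegral.integral_hasDerivAt_right (intervalIntegrable_log_one_add_div hx.le)
    (by fun_prop : Measurable fun t : ℝ =>
      Real.log (1 + t) / t).stronglyMeasurable.stronglyMeasurableAtFilter ?_
  have h : 1 + x ≠ 0 := by positivity
  have h' : x ≠ 0 := hx.ne'
  fun_prop (disch := assumption)

/-- The function `g z = (2/π)^{1/4} exp(π²/12 + z - ∫₀^{e^z} log(1+t)/t dt)` is
log-concave: `z ↦ -log g z` is strictly convex, its second derivative being
`e^z / (1 + e^z) > 0` for all `z`. -/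
theorem g_logConcave_secondDeriv
    (g : ℝ → ℝ)
    (hg : ∀ z, g z = (2 / Real.pi) ^ ((1 : ℝ) / 4) *
      Real.exp (Real.pi ^ 2 / 12 + z -
        ∫ t in (0 : ℝ)..(Real.exp z), Real.log (1 + t) / t)) :
    StrictConvexOn ℝ Set.univ (fun z => -Real.log (g z)) ∧
    ∀ z : ℝ,
      deriv (deriv (fun y => -Real.log (g y))) z = Real.exp z / (1 + Real.exp z) ∧
      0 < Real.exp z / (1 + Real.exp z) := by
  have hlog : ∀ z, -Real.log (g z) =
      (∫ t in (0 : ℝ)..(Real.exp z), Real.log (1 + t) / t) - z -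
        (Real.log ((2 / Real.pi) ^ ((1 : ℝ) / 4)) + Real.pi ^ 2 / 12) := fun z => by
    have hc : (2 / Real.pi) ^ ((1 : ℝ) / 4) ≠ 0 := by positivity
    rw [hg, Real.log_mul hc (Real.exp_ne_zero _), Real.log_exp]
    ring
  have hderiv : ∀ z, HasDerivAt (fun y => -Real.log (g y)) (Real.log (1 + Real.exp z) - 1) z := by
    intro z
    simp only [hlog]
    have h := (((hasDerivAt_integral_log_one_add_div (Real.exp_pos z)).comp z
      (Real.hasDerivAt_exp z)).sub (hasDerivAt_id z)).sub_const
        (Real.log ((2 / Real.pi) ^ ((1 : ℝ) / 4)) + Real.pi ^ 2 / 12)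
    rwa [div_mul_cancel₀ _ (Real.exp_ne_zero z)] at h
  have hderiv2 : ∀ z, deriv (deriv fun y => -Real.log (g y)) z =
      Real.exp z / (1 + Real.exp z) := by
    intro z
    rw [funext fun y => (hderiv y).deriv]
    have hne : 1 + Real.exp z ≠ 0 := by positivity
    exact ((((Real.hasDerivAt_exp z).const_add 1).log hne).sub_const 1).deriv
  have hpos : ∀ z, 0 < Real.exp z / (1 + Real.exp z) := fun z => by positivity
  refine ⟨strictConvexOn_univ_of_deriv2_pos
    (continuous_iff_continuousAt.2 fun z => (hderiv z).continuousAt) fun z => ?_,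
    fun z => ⟨hderiv2 z, hpos z⟩⟩
  exact (hpos z).trans_eq (hderiv2 z).symm
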